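/- arXiv:1806.02147 — 2 statements merged into one kernel-verified Lean document; each statement's English description precedes it below -/
import Mathlib

section
/- Let S ∈ 𝒮^{T⁻¹} and define the space reversal (R S) n = −S_{−n}. Then R S ∈ 𝒮^T, and for every n ∈ ℤ one has (T⁻¹ S) n = −(T (R S))_{−n}; that is, T⁻¹ = R T R on 𝒮^{T⁻¹}. -/
/-- The past maximum `M n = sup_{m ≤ n} S m` of a two-sided path. -/
noncomputable def ballMax (S : ℤ → ℤ) (n : ℤ) : ℤ := sSup (S '' Set.Iic n)

/-- The future minimum `I n = inf_{m ≥ n} S m` of a two-sided path. -/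
noncomputable def ballMin (S : ℤ → ℤ) (n : ℤ) : ℤ := sInf (S '' Set.Ici n)

/-- Pitman's transform `(TS) n = 2 M n - S n - 2 M 0`. -/
noncomputable def Tbb (S : ℤ → ℤ) : ℤ → ℤ := fun n => 2 * ballMax S n - S n - 2 * ballMax S 0

/-- The inverse transform `(T⁻¹S) n = 2 I n - S n - 2 I 0`. -/
noncomputable def TbbInv (S : ℤ → ℤ) : ℤ → ℤ := fun n => 2 * ballMin S n - S n - 2 * ballMin S 0

theorem image_reversal_Iic (S : ℤ → ℤ) (n : ℤ) :
    (fun m : ℤ => -S (-m)) '' Set.Iic (-n) = -(S '' Set.Ici n) := by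
  rw [← Set.image_neg_eq_neg, Set.image_image, ← Set.image_neg_Ici, Set.image_image]
  simp

theorem bddBelow_image_Ici {S : ℤ → ℤ} {k : ℤ} (h : BddBelow (S '' Set.Ici k)) (n : ℤ) :
    BddBelow (S '' Set.Ici n) := by
  refine (((Set.finite_Icc n k).image S).bddBelow.union h).mono ?_
  rw [← Set.image_union]
  refine Set.image_mono fun m hm => ?_
  rcases le_total m k with hk | hk
  · exact Or.inl ⟨hm, hk⟩
  · exact Or.inr hk

theorem ballMax_reversal {S : ℤ → ℤ} {n : ℤ} (h : BddBelow (S '' Set.Ici n)) :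
    ballMax (fun m : ℤ => -S (-m)) (-n) = -ballMin S n := by
  rw [ballMax, ballMin, image_reversal_Iic, csSup_neg (Set.nonempty_Ici.image S) h]

/-- For `S ∈ 𝒮^{T⁻¹}`, the space reversal `(RS) n = -S (-n)` lies in `𝒮^T`,
and `T⁻¹ = R T R` on `𝒮^{T⁻¹}`, i.e. `(T⁻¹S) n = -(T(RS))(-n)` for all `n`. -/
theorem stmt_5 (S : ℤ → ℤ) (hS0 : S 0 = 0)
    (hS : ∀ n : ℤ, |S n - S (n - 1)| = 1)
    (hBdd : BddBelow (S '' Set.Ici 0)) :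
    ((fun n : ℤ => -S (-n)) 0 = 0 ∧
      (∀ n : ℤ, |(fun m : ℤ => -S (-m)) n - (fun m : ℤ => -S (-m)) (n - 1)| = 1) ∧
      BddAbove ((fun n : ℤ => -S (-n)) '' Set.Iic 0)) ∧
    ∀ n : ℤ, TbbInv S n = - Tbb (fun m : ℤ => -S (-m)) (-n) := by
  have hmax := fun n : ℤ => ballMax_reversal (bddBelow_image_Ici hBdd n)
  refine ⟨⟨by simp [hS0], fun n => ?_, ?_⟩, fun n => ?_⟩
  · beta_reduce
    have h := hS (-n + 1)
    rw [add_sub_cancel_right] at h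
    rw [show -(n - 1) = -n + 1 by ring]
    rwa [neg_sub_neg]
  · have h := image_reversal_Iic S 0
    rw [neg_zero] at h
    rw [h]
    exact hBdd.neg
  · have h0 := hmax 0
    rw [neg_zero] at h0
    simp only [TbbInv, Tbb, hmax n, h0, neg_neg]
    ring
end

section
/- For S ∈ 𝒮⁰ the following are equivalent: (a) S ∈ 𝒮^{inv}; (b) S lies in (𝒮⁻_{sub-critical} ∪ 𝒮⁻_{critical}) ∩ (𝒮⁺_{sub-critical} ∪ 𝒮⁺_{critical}), i.e. there exist *₁, *₂, each either a strictly increasing F : ℤ → ℝ or an integer K ≥ 1, with S ∈ 𝒮⁻_{*₁} ∩ 𝒮⁺_{*₂}. Moreover, the box-ball dynamics preserve each such class: if S ∈ 𝒮^{inv} and S ∈ 𝒮⁺_F (respectively 𝒮⁺_K, 𝒮⁻_F, 𝒮⁻_K) for some fixed F or K, then T^k S ∈ 𝒮⁺_F (respectively 𝒮⁺_K, 𝒮⁻_F, 𝒮⁻_K) for every k ∈ ℤ. -/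
/-- The `k`-th iterate `T^k`, using `T` for `k ≥ 0` and `T⁻¹` for `k < 0`. -/
noncomputable def Titer (k : ℤ) (S : ℤ → ℤ) : ℤ → ℤ :=
  if 0 ≤ k then Tbb^[k.toNat] S else TbbInv^[(-k).toNat] S

/-- `S ∈ 𝒮⁰`: a two-sided nearest-neighbour path started at `0`. -/
def inS0 (S : ℤ → ℤ) : Prop := S 0 = 0 ∧ ∀ n : ℤ, |S n - S (n - 1)| = 1

/-- `S ∈ 𝒮^{rev}`: the reversible set. -/
def inSrev (S : ℤ → ℤ) : Prop :=
  inS0 S ∧ BddAbove (S '' Set.Iic 0) ∧ BddBelow (S '' Set.Ici 0) ∧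
    Filter.limsup (fun n : ℤ => ((S n : ℝ) : EReal)) Filter.atTop
      = ⨆ n : ℤ, ((S n : ℝ) : EReal) ∧
    Filter.liminf (fun n : ℤ => ((S n : ℝ) : EReal)) Filter.atBot
      = ⨅ n : ℤ, ((S n : ℝ) : EReal)

/-- `S ∈ 𝒮^{inv}`: all iterates of the dynamics lie in the reversible set. -/
def inSinv (S : ℤ → ℤ) : Prop := ∀ k : ℤ, inSrev (Titer k S)

/-- `S ∈ 𝒮⁺_F`: `S n / F n → 1` as `n → +∞`. -/
def inSplusF (F : ℤ → ℝ) (S : ℤ → ℤ) : Prop :=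
  Filter.Tendsto (fun n : ℤ => (S n : ℝ) / F n) Filter.atTop (nhds 1)

/-- `S ∈ 𝒮⁻_F`: `S n / F n → 1` as `n → -∞`. -/
def inSminusF (F : ℤ → ℝ) (S : ℤ → ℤ) : Prop :=
  Filter.Tendsto (fun n : ℤ => (S n : ℝ) / F n) Filter.atBot (nhds 1)

/-- `S ∈ 𝒮⁺_K` for an integer `K ≥ 1` (formulated in `EReal` so that the suprema are always
defined, with equality to the finite value `K` enforcing the required finiteness). -/
def inSplusK (K : ℤ) (S : ℤ → ℤ) : Prop :=
  (⨆ n : ℤ, ((⨆ m ∈ Set.Iic n, ((S m : ℝ) : EReal)) - ⨅ m ∈ Set.Ici n, ((S m : ℝ) : EReal)))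
      = ((K : ℝ) : EReal) ∧
  Filter.limsup (fun n : ℤ => ((S n : ℝ) : EReal)) Filter.atTop
      - Filter.liminf (fun n : ℤ => ((S n : ℝ) : EReal)) Filter.atTop = ((K : ℝ) : EReal)

/-- `S ∈ 𝒮⁻_K` for an integer `K ≥ 1`. -/
def inSminusK (K : ℤ) (S : ℤ → ℤ) : Prop :=
  (⨆ n : ℤ, ((⨆ m ∈ Set.Iic n, ((S m : ℝ) : EReal)) - ⨅ m ∈ Set.Ici n, ((S m : ℝ) : EReal)))
      = ((K : ℝ) : EReal) ∧
  Filter.limsup (fun n : ℤ => ((S n : ℝ) : EReal)) Filter.atBot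
      - Filter.liminf (fun n : ℤ => ((S n : ℝ) : EReal)) Filter.atBot = ((K : ℝ) : EReal)

/-- `S ∈ 𝒮⁺_{sub-critical}`: `S ∈ 𝒮⁺_F` for some strictly increasing `F : ℤ → ℝ`. -/
def inSplusSub (S : ℤ → ℤ) : Prop := ∃ F : ℤ → ℝ, StrictMono F ∧ inSplusF F S

/-- `S ∈ 𝒮⁻_{sub-critical}`. -/
def inSminusSub (S : ℤ → ℤ) : Prop := ∃ F : ℤ → ℝ, StrictMono F ∧ inSminusF F S

/-- `S ∈ 𝒮⁺_{critical}`: `S ∈ 𝒮⁺_K` for some integer `K ≥ 1`. -/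
def inSplusCrit (S : ℤ → ℤ) : Prop := ∃ K : ℤ, 1 ≤ K ∧ inSplusK K S

/-- `S ∈ 𝒮⁻_{critical}`. -/
def inSminusCrit (S : ℤ → ℤ) : Prop := ∃ K : ℤ, 1 ≤ K ∧ inSminusK K S

open Filter Topology

/-- The time-space reversal `n ↦ -S (-n)`, which conjugates `T` to `T⁻¹`. -/
def pathRev (S : ℤ → ℤ) : ℤ → ℤ := fun n => -S (-n)

lemma pathRev_pathRev (S : ℤ → ℤ) : pathRev (pathRev S) = S := by
  funext n; simp [pathRev]

lemma ballMin_eq (S : ℤ → ℤ) (n : ℤ) : ballMin S n = -ballMax (pathRev S) (-n) := by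
  unfold ballMin ballMax
  have : pathRev S '' Set.Iic (-n) = -(S '' Set.Ici n) := by
    ext x
    simp only [Set.mem_image, Set.mem_Iic, Set.mem_neg, Set.mem_Ici, pathRev]
    constructor
    · rintro ⟨m, hm, rfl⟩
      exact ⟨-m, by omega, by omega⟩
    · rintro ⟨m, hm, h⟩
      exact ⟨-m, by omega, by rw [neg_neg]; omega⟩
  rw [this]
  by_cases h : BddBelow (S '' Set.Ici n)
  · rw [csSup_neg (Set.nonempty_Ici.image S) h, neg_neg]
  · rw [Int.csInf_of_not_bddBelow h, Int.csSup_of_not_bddAbove (by rwa [bddAbove_neg]), neg_zero]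

lemma TbbInv_pathRev (S : ℤ → ℤ) : TbbInv (pathRev S) = pathRev (Tbb S) := by
  funext n
  simp only [TbbInv, ballMin_eq, pathRev_pathRev]
  simp only [pathRev, Tbb, neg_zero]
  ring

lemma TbbInv_eq (S : ℤ → ℤ) : TbbInv S = pathRev (Tbb (pathRev S)) := by
  rw [← TbbInv_pathRev, pathRev_pathRev]

lemma Tbb_pathRev (S : ℤ → ℤ) : Tbb (pathRev S) = pathRev (TbbInv S) := by
  rw [TbbInv_eq, pathRev_pathRev]

section BallMax

variable {S : ℤ → ℤ} (hb : ∃ B, ∀ n ≤ 0, S n ≤ B)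
include hb

lemma bddAbove_image_Iic (n : ℤ) : BddAbove (S '' Set.Iic n) := by
  obtain ⟨B, hB⟩ := hb
  obtain ⟨C, hC⟩ := ((Set.finite_Icc 0 n).image S).bddAbove
  refine ⟨max B C, ?_⟩
  rintro _ ⟨m, hm, rfl⟩
  rcases le_total m 0 with h | h
  · exact le_max_of_le_left (hB m h)
  · exact le_max_of_le_right (hC ⟨m, ⟨h, hm⟩, rfl⟩)

lemma le_ballMax {m n : ℤ} (h : m ≤ n) : S m ≤ ballMax S n :=
  le_csSup (bddAbove_image_Iic hb n) ⟨m, h, rfl⟩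

lemma exists_eq_ballMax (n : ℤ) : ∃ m ≤ n, S m = ballMax S n :=
  Int.csSup_mem (Set.nonempty_Iic.image S) (bddAbove_image_Iic hb n)

lemma ballMax_mono : Monotone (ballMax S) := by
  intro m n h
  obtain ⟨l, hl, e⟩ := exists_eq_ballMax hb m
  exact e ▸ le_ballMax hb (hl.trans h)

end BallMax

section EReal

variable {f : Filter ℤ} {S : ℤ → ℤ}

lemma limsup_eq_intCast [f.NeBot] {A : ℤ} (h₁ : ∀ᶠ n in f, S n ≤ A) (h₂ : ∃ᶠ n in f, S n = A) :
    limsup (fun n => ((S n : ℝ) : EReal)) f = ((A : ℝ) : EReal) := by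
  apply le_antisymm
  · exact limsup_le_of_le (h := h₁.mono fun n hn => by exact_mod_cast hn)
  · exact le_limsup_of_frequently_le (h₂.mono fun n hn => by rw [hn])

lemma exists_of_limsup_eq_coe [f.NeBot] {x : ℝ}
    (h : limsup (fun n => ((S n : ℝ) : EReal)) f = (x : EReal)) :
    ∃ A : ℤ, x = A ∧ (∀ᶠ n in f, S n ≤ A) ∧ ∃ᶠ n in f, S n = A := by
  have h₁ : ∀ᶠ n in f, S n ≤ ⌊x⌋ := by
    have : limsup (fun n => ((S n : ℝ) : EReal)) f < (((⌊x⌋ + 1 : ℤ) : ℝ) : EReal) := by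
      rw [h]
      have := Int.lt_floor_add_one x
      exact_mod_cast this
    filter_upwards [eventually_lt_of_limsup_lt this] with n hn
    have : S n < ⌊x⌋ + 1 := by exact_mod_cast hn
    omega
  have h₂ : ∃ᶠ n in f, S n = ⌊x⌋ := by
    have : (((⌊x⌋ - 1 : ℤ) : ℝ) : EReal) < limsup (fun n => ((S n : ℝ) : EReal)) f := by
      rw [h, EReal.coe_lt_coe_iff]
      have := Int.floor_le x
      push_cast
      linarith
    refine ((frequently_lt_of_lt_limsup (by isBoundedDefault) this).and_eventually h₁).mono ?_
    rintro n ⟨hn, hn'⟩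
    have : ⌊x⌋ - 1 < S n := by exact_mod_cast hn
    omega
  refine ⟨⌊x⌋, ?_, h₁, h₂⟩
  have := limsup_eq_intCast h₁ h₂
  rw [h] at this
  exact_mod_cast this

lemma liminf_intCast_eq_neg_limsup :
    liminf (fun n => ((S n : ℝ) : EReal)) f
      = -limsup (fun n => (((-S n : ℤ) : ℝ) : EReal)) f := by
  rw [← EReal.liminf_neg]
  congr 1
  funext n
  simp

lemma liminf_eq_intCast [f.NeBot] {A : ℤ} (h₁ : ∀ᶠ n in f, A ≤ S n) (h₂ : ∃ᶠ n in f, S n = A) :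
    liminf (fun n => ((S n : ℝ) : EReal)) f = ((A : ℝ) : EReal) := by
  rw [liminf_intCast_eq_neg_limsup, limsup_eq_intCast (A := -A)]
  · simp
  · filter_upwards [h₁] with n hn
    omega
  · exact h₂.mono fun n hn => by omega

lemma exists_of_liminf_eq_coe [f.NeBot] {x : ℝ}
    (h : liminf (fun n => ((S n : ℝ) : EReal)) f = (x : EReal)) :
    ∃ A : ℤ, x = A ∧ (∀ᶠ n in f, A ≤ S n) ∧ ∃ᶠ n in f, S n = A := by
  rw [liminf_intCast_eq_neg_limsup, neg_eq_iff_eq_neg, ← EReal.coe_neg] at h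
  obtain ⟨A, e, h₁, h₂⟩ := exists_of_limsup_eq_coe h
  refine ⟨-A, by push_cast; linarith, ?_, h₂.mono fun n hn => by omega⟩
  filter_upwards [h₁] with n hn
  omega

/-- Along `f`, the path eventually stays in `[a, a + K]` and visits both ends infinitely often. -/
def OscillatesIn (f : Filter ℤ) (a K : ℤ) (S : ℤ → ℤ) : Prop :=
  (∀ᶠ n in f, a ≤ S n ∧ S n ≤ a + K) ∧ (∃ᶠ n in f, S n = a) ∧ ∃ᶠ n in f, S n = a + K

/-- The path never falls by more than `K`. -/
def DropLE (K : ℤ) (S : ℤ → ℤ) : Prop := ∀ m l : ℤ, m ≤ l → S m ≤ S l + K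

lemma limsup_sub_liminf_eq_iff [f.NeBot] {K : ℤ} :
    limsup (fun n => ((S n : ℝ) : EReal)) f - liminf (fun n => ((S n : ℝ) : EReal)) f
      = ((K : ℝ) : EReal) ↔ ∃ a, OscillatesIn f a K S := by
  constructor
  · intro h
    have hfin : ∀ X Y : EReal, X - Y = ((K : ℝ) : EReal) →
        ∃ x y : ℝ, X = x ∧ Y = y ∧ x - y = K := by
      intro X Y h
      induction X with
      | bot => simp at h
      | top =>
        induction Y with
        | bot => simp at h
        | top => simp at h
        | coe y => simp at h
      | coe x =>
        induction Y with
        | bot => simp at h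
        | top => simp at h
        | coe y => exact ⟨x, y, rfl, rfl, by exact_mod_cast h⟩
    obtain ⟨x, y, hx, hy, hxy⟩ := hfin _ _ h
    obtain ⟨A, rfl, h₁, h₂⟩ := exists_of_limsup_eq_coe hx
    obtain ⟨a, rfl, h₃, h₄⟩ := exists_of_liminf_eq_coe hy
    have hA : A = a + K := by
      have : A - a = K := by exact_mod_cast hxy
      omega
    subst hA
    exact ⟨a, h₃.and h₁, h₄, h₂⟩
  · rintro ⟨a, h₁, h₂, h₃⟩
    rw [limsup_eq_intCast (h₁.mono fun n h => h.2) h₃, liminf_eq_intCast (h₁.mono fun n h => h.1) h₂,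
      ← EReal.coe_sub]
    simp

lemma iSup_sub_iInf_le_iff {K : ℤ} :
    (⨆ n : ℤ, ((⨆ m ∈ Set.Iic n, ((S m : ℝ) : EReal)) - ⨅ m ∈ Set.Ici n, ((S m : ℝ) : EReal)))
      ≤ ((K : ℝ) : EReal) ↔ DropLE K S := by
  constructor
  · intro h m l hml
    have h₁ : ((S m : ℝ) : EReal) - ((S l : ℝ) : EReal) ≤ ((K : ℝ) : EReal) := by
      refine le_trans (EReal.sub_le_sub ?_ ?_) ((le_iSup _ m).trans h)
      · exact le_iSup₂_of_le m Set.self_mem_Iic le_rfl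
      · exact iInf₂_le_of_le l hml le_rfl
    have h₂ : S m - S l ≤ K := by exact_mod_cast h₁
    omega
  · intro h
    refine iSup_le fun n => EReal.sub_le_of_le_add ?_
    refine iSup₂_le fun m hm => ?_
    rw [add_comm]
    rw [← EReal.sub_le_iff_le_add (by simp) (by simp)]
    refine le_iInf₂ fun l hl => ?_
    have h₁ : S m - K ≤ S l := by have := h m l (le_trans hm hl); omega
    exact_mod_cast h₁

lemma le_iSup_sub_iInf {K m l : ℤ} (hml : m ≤ l) (h : S m = S l + K) :
    ((K : ℝ) : EReal) ≤
    ⨆ n : ℤ, ((⨆ m ∈ Set.Iic n, ((S m : ℝ) : EReal)) - ⨅ m ∈ Set.Ici n, ((S m : ℝ) : EReal)) := by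
  refine le_trans ?_ (le_iSup _ m)
  have : ((K : ℝ) : EReal) = ((S m : ℝ) : EReal) - ((S l : ℝ) : EReal) := by
    rw [h]
    norm_cast
    simp
  rw [this]
  apply EReal.sub_le_sub
  · exact le_iSup₂_of_le m Set.self_mem_Iic le_rfl
  · exact iInf₂_le_of_le l hml le_rfl

lemma inSplusK_iff {K : ℤ} : inSplusK K S ↔ DropLE K S ∧ ∃ a, OscillatesIn atTop a K S := by
  rw [inSplusK, limsup_sub_liminf_eq_iff]
  constructor
  · rintro ⟨h, h'⟩
    exact ⟨iSup_sub_iInf_le_iff.1 h.le, h'⟩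
  · rintro ⟨h, a, h'⟩
    refine ⟨le_antisymm (iSup_sub_iInf_le_iff.2 h) ?_, a, h'⟩
    obtain ⟨m, hm⟩ := h'.2.2.exists
    obtain ⟨l, hl, hml⟩ := (h'.2.1.and_eventually (eventually_ge_atTop m)).exists
    exact le_iSup_sub_iInf hml (by omega)

lemma inSminusK_iff {K : ℤ} : inSminusK K S ↔ DropLE K S ∧ ∃ a, OscillatesIn atBot a K S := by
  rw [inSminusK, limsup_sub_liminf_eq_iff]
  constructor
  · rintro ⟨h, h'⟩
    exact ⟨iSup_sub_iInf_le_iff.1 h.le, h'⟩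
  · rintro ⟨h, a, h'⟩
    refine ⟨le_antisymm (iSup_sub_iInf_le_iff.2 h) ?_, a, h'⟩
    obtain ⟨l, hl⟩ := h'.2.1.exists
    obtain ⟨m, hm, hml⟩ := (h'.2.2.and_eventually (eventually_le_atBot l)).exists
    exact le_iSup_sub_iInf hml (by omega)

lemma limsup_eq_iSup_iff [f.NeBot] :
    limsup (fun n => ((S n : ℝ) : EReal)) f = ⨆ n : ℤ, ((S n : ℝ) : EReal) ↔
      ∀ n, ∃ᶠ m in f, S n ≤ S m := by
  constructor
  · intro h n
    have h₁ : (((S n - 1 : ℤ) : ℝ) : EReal) < limsup (fun n => ((S n : ℝ) : EReal)) f := by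
      rw [h]
      refine lt_of_lt_of_le ?_ (le_iSup _ n)
      rw [EReal.coe_lt_coe_iff, Int.cast_lt]
      omega
    refine (frequently_lt_of_lt_limsup (by isBoundedDefault) h₁).mono fun m hm => ?_
    have : S n - 1 < S m := by exact_mod_cast hm
    omega
  · intro h
    refine le_antisymm limsup_le_iSup (iSup_le fun n => ?_)
    exact le_limsup_of_frequently_le ((h n).mono fun m hm => by exact_mod_cast hm)

lemma liminf_eq_iInf_iff [f.NeBot] :
    liminf (fun n => ((S n : ℝ) : EReal)) f = ⨅ n : ℤ, ((S n : ℝ) : EReal) ↔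
      ∀ n, ∃ᶠ m in f, S m ≤ S n := by
  have h : ⨅ n : ℤ, ((S n : ℝ) : EReal) = -⨆ n : ℤ, (((-S n : ℤ) : ℝ) : EReal) := by
    rw [← liminf_top_eq_iInf, liminf_intCast_eq_neg_limsup, limsup_top_eq_iSup]
  rw [liminf_intCast_eq_neg_limsup, h, neg_inj, limsup_eq_iSup_iff (S := fun n => -S n)]
  simp

end EReal

/-- The reversible set, in elementary terms. -/
structure IsRev (S : ℤ → ℤ) : Prop where
  inS0 : inS0 S
  above : ∃ B, ∀ n ≤ 0, S n ≤ B
  below : ∃ B, ∀ n ≥ 0, B ≤ S n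
  top : ∀ n, ∃ᶠ m in atTop, S n ≤ S m
  bot : ∀ n, ∃ᶠ m in atBot, S m ≤ S n

lemma inSrev_iff {S : ℤ → ℤ} : inSrev S ↔ IsRev S := by
  rw [inSrev, limsup_eq_iSup_iff, liminf_eq_iInf_iff]
  have h₁ : BddAbove (S '' Set.Iic 0) ↔ ∃ B, ∀ n ≤ 0, S n ≤ B := by
    simp [bddAbove_def]
  have h₂ : BddBelow (S '' Set.Ici 0) ↔ ∃ B, ∀ n ≥ 0, B ≤ S n := by
    simp [bddBelow_def]
  rw [h₁, h₂]
  exact ⟨fun ⟨a, b, c, d, e⟩ => ⟨a, b, c, d, e⟩, fun ⟨a, b, c, d, e⟩ => ⟨a, b, c, d, e⟩⟩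

lemma inS0.pathRev {S : ℤ → ℤ} (h : _root_.inS0 S) : _root_.inS0 (pathRev S) := by
  refine ⟨by simp [_root_.pathRev, h.1], fun n => ?_⟩
  have := h.2 (-(n - 1))
  rw [show -(n - 1) - 1 = -n by ring] at this
  simp only [_root_.pathRev]
  rwa [neg_sub_neg]

lemma IsRev.pathRev {S : ℤ → ℤ} (h : IsRev S) : IsRev (pathRev S) := by
  obtain ⟨h0, ⟨B, hB⟩, ⟨C, hC⟩, ht, hb⟩ := h
  refine ⟨h0.pathRev, ⟨-C, fun n hn => ?_⟩, ⟨-B, fun n hn => ?_⟩,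
    fun n => ?_, fun n => ?_⟩
  · have := hC (-n) (by omega)
    simp only [_root_.pathRev]
    omega
  · have := hB (-n) (by omega)
    simp only [_root_.pathRev]
    omega
  · have := tendsto_neg_atBot_atTop.frequently (p := fun m => _root_.pathRev S n ≤ _root_.pathRev S m)
      (by simpa [_root_.pathRev] using hb (-n))
    exact this
  · have := tendsto_neg_atTop_atBot.frequently (p := fun m => _root_.pathRev S m ≤ _root_.pathRev S n)
      (by simpa [_root_.pathRev] using ht (-n))
    exact this

lemma OscillatesIn.pathRev_atTop {S : ℤ → ℤ} {a K : ℤ} (h : OscillatesIn atTop a K S) :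
    OscillatesIn atBot (-(a + K)) K (pathRev S) := by
  obtain ⟨h₁, h₂, h₃⟩ := h
  refine ⟨?_, ?_, ?_⟩
  · filter_upwards [tendsto_neg_atBot_atTop.eventually h₁] with n hn
    simp only [pathRev]
    omega
  · refine (tendsto_neg_atTop_atBot (G := ℤ)).frequently (h₃.mono fun n hn => ?_)
    simp [pathRev, hn]
  · refine (tendsto_neg_atTop_atBot (G := ℤ)).frequently (h₂.mono fun n hn => ?_)
    simp [pathRev, hn]

lemma OscillatesIn.pathRev_atBot {S : ℤ → ℤ} {a K : ℤ} (h : OscillatesIn atBot a K S) :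
    OscillatesIn atTop (-(a + K)) K (pathRev S) := by
  obtain ⟨h₁, h₂, h₃⟩ := h
  refine ⟨?_, ?_, ?_⟩
  · filter_upwards [tendsto_neg_atTop_atBot.eventually h₁] with n hn
    simp only [pathRev]
    omega
  · refine (tendsto_neg_atBot_atTop (G := ℤ)).frequently (h₃.mono fun n hn => ?_)
    simp [pathRev, hn]
  · refine (tendsto_neg_atBot_atTop (G := ℤ)).frequently (h₂.mono fun n hn => ?_)
    simp [pathRev, hn]

lemma DropLE.pathRev {S : ℤ → ℤ} {K : ℤ} (h : DropLE K S) : DropLE K (pathRev S) := by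
  intro m l hml
  have := h (-l) (-m) (by omega)
  simp only [_root_.pathRev]
  omega

section Step

variable {S : ℤ → ℤ}

lemma inS0.Tbb (h : inS0 S) (hb : ∃ B, ∀ n ≤ 0, S n ≤ B) : inS0 (Tbb S) := by
  refine ⟨by simp [_root_.Tbb, h.1], fun n => ?_⟩
  have h₁ := h.2 n
  have h₂ := le_ballMax hb (le_refl n)
  have h₃ := le_ballMax hb (le_refl (n - 1))
  have h₄ := ballMax_mono hb (show n - 1 ≤ n by omega)
  obtain ⟨j, hj, e⟩ := exists_eq_ballMax hb n
  have h₅ : ballMax S n = S n ∨ ballMax S n ≤ ballMax S (n - 1) := by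
    rcases hj.eq_or_lt with rfl | hlt
    · exact Or.inl e.symm
    · exact Or.inr (e ▸ le_ballMax hb (by omega))
  simp only [_root_.Tbb]
  rw [abs_eq (by norm_num)] at h₁ ⊢
  omega

lemma ballMax_le_Tbb (hb : ∃ B, ∀ n ≤ 0, S n ≤ B) (n : ℤ) :
    ballMax S n - 2 * ballMax S 0 ≤ Tbb S n := by
  have := le_ballMax hb (le_refl n)
  simp only [Tbb]
  omega

lemma DropLE.Tbb {K : ℤ} (hb : ∃ B, ∀ n ≤ 0, S n ≤ B) (h : DropLE K S) : DropLE K (Tbb S) := by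
  intro m l hml
  have h₁ := ballMax_le_Tbb hb l
  have h₂ := ballMax_mono hb hml
  obtain ⟨j, hj, e⟩ := exists_eq_ballMax hb m
  have h₃ := h j m hj
  simp only [_root_.Tbb] at h₁ ⊢
  omega

lemma OscillatesIn.Tbb {f : Filter ℤ} {a K : ℤ} (h : OscillatesIn f a K S)
    (hM : ∀ᶠ n in f, ballMax S n = a + K) :
    OscillatesIn f (a + K - 2 * ballMax S 0) K (Tbb S) := by
  obtain ⟨h₁, h₂, h₃⟩ := h
  refine ⟨?_, ?_, ?_⟩
  · filter_upwards [h₁, hM] with n hn hn'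
    simp only [_root_.Tbb]
    omega
  · refine (h₃.and_eventually hM).mono fun n hn => ?_
    simp only [_root_.Tbb]
    omega
  · refine (h₂.and_eventually hM).mono fun n hn => ?_
    simp only [_root_.Tbb]
    omega

lemma OscillatesIn.le_of_isRev {a K : ℤ} (h : OscillatesIn atTop a K S) (hS : IsRev S) (n : ℤ) :
    S n ≤ a + K := by
  obtain ⟨m, hm, hm'⟩ := ((hS.top n).and_eventually h.1).exists
  omega

lemma OscillatesIn.ballMax_atTop {a K : ℤ} (h : OscillatesIn atTop a K S) (hS : IsRev S) :
    ∀ᶠ n in atTop, ballMax S n = a + K := by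
  obtain ⟨m, hm⟩ := h.2.2.exists
  filter_upwards [eventually_ge_atTop m] with n hn
  have h₁ := le_ballMax hS.above hn
  obtain ⟨j, -, e⟩ := exists_eq_ballMax hS.above n
  have h₂ := h.le_of_isRev hS j
  omega

lemma OscillatesIn.ballMax_atBot {a K : ℤ} (h : OscillatesIn atBot a K S)
    (hb : ∃ B, ∀ n ≤ 0, S n ≤ B) : ∀ᶠ n in atBot, ballMax S n = a + K := by
  obtain ⟨N, hN⟩ := eventually_atBot.1 h.1
  filter_upwards [eventually_le_atBot N] with n hn
  obtain ⟨m, hm, hmn⟩ := (h.2.2.and_eventually (eventually_le_atBot n)).exists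
  have h₁ := le_ballMax hb hmn
  obtain ⟨j, hj, e⟩ := exists_eq_ballMax hb n
  have h₂ := (hN j (hj.trans hn)).2
  omega

lemma inSplusK.Tbb {K : ℤ} (hS : IsRev S) (h : inSplusK K S) : inSplusK K (Tbb S) := by
  rw [inSplusK_iff] at h ⊢
  obtain ⟨h₁, a, h₂⟩ := h
  exact ⟨h₁.Tbb hS.above, _, h₂.Tbb (h₂.ballMax_atTop hS)⟩

lemma inSminusK.Tbb {K : ℤ} (hS : IsRev S) (h : inSminusK K S) : inSminusK K (Tbb S) := by
  rw [inSminusK_iff] at h ⊢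
  obtain ⟨h₁, a, h₂⟩ := h
  exact ⟨h₁.Tbb hS.above, _, h₂.Tbb (h₂.ballMax_atBot hS.above)⟩

lemma inSplusK.pathRev {K : ℤ} (h : inSplusK K S) : inSminusK K (pathRev S) := by
  rw [inSplusK_iff] at h
  rw [inSminusK_iff]
  obtain ⟨h₁, a, h₂⟩ := h
  exact ⟨h₁.pathRev, _, h₂.pathRev_atTop⟩

lemma inSminusK.pathRev {K : ℤ} (h : inSminusK K S) : inSplusK K (pathRev S) := by
  rw [inSminusK_iff] at h
  rw [inSplusK_iff]
  obtain ⟨h₁, a, h₂⟩ := h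
  exact ⟨h₁.pathRev, _, h₂.pathRev_atBot⟩

/-- The reversal of a real-valued function on `ℤ`. -/
def realRev (F : ℤ → ℝ) : ℤ → ℝ := fun n => -F (-n)

lemma realRev_realRev (F : ℤ → ℝ) : realRev (realRev F) = F := by
  funext n; simp [realRev]

lemma StrictMono.realRev {F : ℤ → ℝ} (h : StrictMono F) : StrictMono (realRev F) := by
  intro m n hmn
  have := h (neg_lt_neg hmn)
  simp only [_root_.realRev]
  linarith

lemma inSplusF.pathRev {F : ℤ → ℝ} (h : inSplusF F S) : inSminusF (realRev F) (pathRev S) := by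
  have := Tendsto.comp h (tendsto_neg_atBot_atTop (G := ℤ))
  refine this.congr fun n => ?_
  simp [_root_.pathRev, realRev, neg_div_neg_eq]

lemma inSminusF.pathRev {F : ℤ → ℝ} (h : inSminusF F S) : inSplusF (realRev F) (pathRev S) := by
  have := Tendsto.comp h (tendsto_neg_atTop_atBot (G := ℤ))
  refine this.congr fun n => ?_
  simp [_root_.pathRev, realRev, neg_div_neg_eq]

lemma inSplusF.tendsto_atTop {F : ℤ → ℝ} (h : inSplusF F S) (hF : StrictMono F) (hS : inS0 S) :
    Tendsto F atTop atTop := by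
  rcases tendsto_atTop_of_monotone hF.monotone with hF' | ⟨l, hl⟩
  · exact hF'
  · exfalso
    have h₁ : Tendsto (fun n => (S n : ℝ)) atTop (𝓝 (1 * l)) := by
      refine (Tendsto.mul h hl).congr' ?_
      filter_upwards [h.eventually_ne one_ne_zero] with n hn
      have : F n ≠ 0 := by
        intro h0
        simp [h0] at hn
      field_simp
    have h₂ : Tendsto (fun n => (S (n - 1) : ℝ)) atTop (𝓝 (1 * l)) :=
      h₁.comp (tendsto_atTop_add_const_right atTop (-1 : ℤ) tendsto_id)
    have h₃ := (h₁.sub h₂).abs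
    have h₄ : (fun n => |(S n : ℝ) - S (n - 1)|) = fun _ => (1 : ℝ) := by
      funext n
      exact_mod_cast hS.2 n
    rw [h₄, sub_self, abs_zero] at h₃
    exact one_ne_zero (tendsto_nhds_unique tendsto_const_nhds h₃)

lemma inSplusF.tendsto_path {F : ℤ → ℝ} (h : inSplusF F S) (hF : StrictMono F) (hS : inS0 S) :
    Tendsto S atTop atTop := by
  have hF' := h.tendsto_atTop hF hS
  rw [← tendsto_intCast_atTop_iff (R := ℝ)]
  refine (Tendsto.pos_mul_atTop one_pos h hF').congr' ?_
  filter_upwards [hF'.eventually_gt_atTop 0] with n hn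
  field_simp

lemma tendsto_realRev {F : ℤ → ℝ} (h : Tendsto (realRev F) atTop atTop) :
    Tendsto F atBot atBot := by
  have := tendsto_neg_atTop_atBot.comp (h.comp (tendsto_neg_atBot_atTop (G := ℤ)))
  refine this.congr fun n => ?_
  simp [realRev]

lemma inSminusF.tendsto_atBot {F : ℤ → ℝ} (h : inSminusF F S) (hF : StrictMono F) (hS : inS0 S) :
    Tendsto F atBot atBot :=
  tendsto_realRev (h.pathRev.tendsto_atTop hF.realRev hS.pathRev)

lemma inSminusF.tendsto_path {F : ℤ → ℝ} (h : inSminusF F S) (hF : StrictMono F) (hS : inS0 S) :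
    Tendsto S atBot atBot := by
  have h₁ := h.pathRev.tendsto_path hF.realRev hS.pathRev
  have := tendsto_neg_atTop_atBot.comp (h₁.comp (tendsto_neg_atBot_atTop (G := ℤ)))
  refine this.congr fun n => ?_
  simp [_root_.pathRev]

lemma tendsto_Tbb_div {f : Filter ℤ} {F : ℤ → ℝ}
    (h : Tendsto (fun n => (S n : ℝ) / F n) f (𝓝 1)) (hF : Tendsto (fun n => |F n|) f atTop)
    (hM : Tendsto (fun n => (ballMax S n : ℝ) / F n) f (𝓝 1)) :
    Tendsto (fun n => (Tbb S n : ℝ) / F n) f (𝓝 1) := by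
  have h₀ : Tendsto (fun n => (2 * ballMax S 0 : ℝ) / F n) f (𝓝 0) := by
    rw [tendsto_zero_iff_abs_tendsto_zero]
    refine (Tendsto.div_atTop (tendsto_const_nhds (x := |(2 * ballMax S 0 : ℝ)|)) hF).congr
      fun n => ?_
    simp [Function.comp, abs_div]
  have := ((hM.const_mul 2).sub h).sub h₀
  rw [show (2 * 1 - 1 - 0 : ℝ) = 1 by norm_num] at this
  refine this.congr fun n => ?_
  simp only [Tbb]
  push_cast
  ring

lemma inSplusF.Tbb {F : ℤ → ℝ} (h : inSplusF F S) (hF : StrictMono F) (hS : IsRev S) :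
    inSplusF F (Tbb S) := by
  have hF' := h.tendsto_atTop hF hS.inS0
  refine tendsto_Tbb_div h (tendsto_abs_atTop_atTop.comp hF') ?_
  rw [inSplusF, tendsto_order] at h
  rw [tendsto_order]
  constructor
  · intro a ha
    filter_upwards [h.1 a ha, hF'.eventually_gt_atTop 0] with n hn hn'
    refine hn.trans_le (div_le_div_of_nonneg_right ?_ hn'.le)
    exact_mod_cast le_ballMax hS.above le_rfl
  · intro b hb
    obtain ⟨N, hN⟩ := eventually_atTop.1 ((h.2 b hb).and (hF'.eventually_gt_atTop 0))
    filter_upwards [hF'.eventually_gt_atTop 0, hF'.eventually_gt_atTop (ballMax S N : ℝ),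
      eventually_ge_atTop N] with n hn hn' hn''
    rw [div_lt_iff₀ hn]
    obtain ⟨j, hj, e⟩ := exists_eq_ballMax hS.above n
    rcases le_total j N with hjN | hjN
    · have h₁ : (S j : ℝ) ≤ ballMax S N := by exact_mod_cast le_ballMax hS.above hjN
      rw [← e]
      nlinarith
    · obtain ⟨h₁, h₂⟩ := hN j hjN
      rw [div_lt_iff₀ h₂] at h₁
      rw [← e]
      have := hF.monotone hj
      nlinarith

lemma inSminusF.Tbb {F : ℤ → ℝ} (h : inSminusF F S) (hF : StrictMono F) (hS : IsRev S) :
    inSminusF F (Tbb S) := by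
  have hF' := h.tendsto_atBot hF hS.inS0
  refine tendsto_Tbb_div h (tendsto_abs_atBot_atTop.comp hF') ?_
  rw [inSminusF, tendsto_order] at h
  rw [tendsto_order]
  constructor
  · intro a ha
    have ha' : max a 0 < 1 := max_lt ha one_pos
    obtain ⟨N, hN⟩ := eventually_atBot.1 ((h.1 _ ha').and (hF'.eventually_lt_atBot 0))
    filter_upwards [eventually_le_atBot N] with n hn
    obtain ⟨j, hj, e⟩ := exists_eq_ballMax hS.above n
    obtain ⟨h₁, h₂⟩ := hN j (hj.trans hn)
    have h₃ := (hN n hn).2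
    refine (le_max_left a 0).trans_lt ?_
    rw [lt_div_iff_of_neg h₂] at h₁
    rw [lt_div_iff_of_neg h₃, ← e]
    have := hF.monotone hj
    have := le_max_right a 0
    nlinarith
  · intro b hb
    filter_upwards [h.2 b hb, hF'.eventually_lt_atBot 0] with n hn hn'
    refine lt_of_le_of_lt (div_le_div_of_nonpos_of_le hn'.le ?_) hn
    exact_mod_cast le_ballMax hS.above le_rfl

end Step

section BallMin

variable {S : ℤ → ℤ} (hS : IsRev S)
include hS

lemma IsRev.ballMin_le {m n : ℤ} (h : n ≤ m) : ballMin S n ≤ S m := by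
  have := le_ballMax hS.pathRev.above (neg_le_neg h)
  simp only [ballMin_eq]
  simp only [_root_.pathRev, neg_neg] at this
  omega

lemma IsRev.exists_eq_ballMin (n : ℤ) : ∃ m ≥ n, S m = ballMin S n := by
  obtain ⟨m, hm, e⟩ := exists_eq_ballMax hS.pathRev.above (-n)
  refine ⟨-m, by omega, ?_⟩
  rw [ballMin_eq, ← e, _root_.pathRev, neg_neg]

lemma IsRev.ballMin_mono : Monotone (ballMin S) := by
  intro m n h
  obtain ⟨l, hl, e⟩ := hS.exists_eq_ballMin n
  exact e ▸ hS.ballMin_le (h.trans hl)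

lemma IsRev.exists_ge_eq_ballMax (n : ℤ) :
    ∃ m ≥ n, S m = ballMax S n ∧ ballMax S m = ballMax S n := by
  obtain ⟨j, -, e⟩ := exists_eq_ballMax hS.above n
  have hex : ∃ m, n ≤ m ∧ ballMax S n ≤ S m := by
    obtain ⟨m, hm, hm'⟩ := ((hS.top j).and_eventually (eventually_ge_atTop n)).exists
    exact ⟨m, hm', e ▸ hm⟩
  obtain ⟨m, ⟨hnm, hm⟩, hmin⟩ := Int.exists_least_of_bdd (P := fun m => n ≤ m ∧ ballMax S n ≤ S m)
    ⟨n, fun z hz => hz.1⟩ hex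
  have hlt : ∀ i, n < i → i < m → S i < ballMax S n := by
    intro i hi him
    by_contra! hc
    have := hmin i ⟨hi.le, hc⟩
    omega
  have heq : S m = ballMax S n := by
    rcases hnm.eq_or_lt with rfl | hlt'
    · exact le_antisymm (le_ballMax hS.above le_rfl) hm
    · have h₁ : S (m - 1) < ballMax S n := by
        by_contra! hc
        have := hmin (m - 1) ⟨by omega, hc⟩
        omega
      have h₂ := hS.inS0.2 m
      rw [abs_eq (by norm_num)] at h₂
      omega
  refine ⟨m, hnm, heq, le_antisymm ?_ (ballMax_mono hS.above hnm)⟩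
  obtain ⟨i, hi, e'⟩ := exists_eq_ballMax hS.above m
  rw [← e']
  rcases le_or_gt i n with h | h
  · exact le_ballMax hS.above h
  · rcases hi.eq_or_lt with rfl | h'
    · exact heq.le
    · exact (hlt i h h').le

lemma IsRev.ballMin_Tbb (n : ℤ) : ballMin (Tbb S) n = ballMax S n - 2 * ballMax S 0 := by
  have hle : ∀ m ≥ n, ballMax S n - 2 * ballMax S 0 ≤ Tbb S m := fun m hm => by
    have h₁ := ballMax_le_Tbb hS.above m
    have h₂ := ballMax_mono hS.above hm
    omega
  obtain ⟨m, hm, h₁, h₂⟩ := hS.exists_ge_eq_ballMax n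
  refine IsLeast.csInf_eq ⟨⟨m, hm, ?_⟩, ?_⟩
  · simp only [Tbb]
    omega
  · rintro _ ⟨l, hl, rfl⟩
    exact hle l hl

lemma IsRev.ballMax_TbbInv (n : ℤ) : ballMax (TbbInv S) n = ballMin S n - 2 * ballMin S 0 := by
  have h := hS.pathRev.ballMin_Tbb (-n)
  rw [ballMin_eq, Tbb_pathRev, pathRev_pathRev, neg_neg] at h
  simp only [ballMin_eq, neg_zero]
  omega

end BallMin

/-- Up to a constant, there are arbitrarily large `L` for which the path has a drop of relative
size `δ` below a past maximum of relative height at most `c`. -/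
def HasRelDrops (c δ : ℝ) (S : ℤ → ℤ) : Prop :=
  ∃ C : ℝ, ∀ B : ℝ, ∃ L ≥ B, ∃ n ≥ 0,
    (ballMax S n : ℝ) ≤ c * L + C ∧ δ * L ≤ ballMax S n - ballMin S n

lemma HasRelDrops.TbbInv {S : ℤ → ℤ} {c δ : ℝ} (hδ : 0 < δ) (hS : IsRev S)
    (hS' : IsRev (TbbInv S)) (h : HasRelDrops c δ S) : HasRelDrops (c - δ) δ (TbbInv S) := by
  obtain ⟨C, hC⟩ := h
  refine ⟨C - 2 * ballMin S 0, fun B => ?_⟩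
  obtain ⟨L, hL, n, hn, h₁, h₂⟩ := hC (max B ((ballMax S 0 - ballMin S 0 + 1) / δ))
  have hL' : (ballMax S 0 - ballMin S 0 + 1 : ℝ) ≤ δ * L := by
    have := (le_max_right _ _).trans hL
    rwa [div_le_iff₀' hδ] at this
  obtain ⟨j, hj, e⟩ := exists_eq_ballMax hS.above n
  have hI : (ballMin S j : ℝ) ≤ ballMin S n := by exact_mod_cast hS.ballMin_mono hj
  have hj0 : 0 ≤ j := by
    by_contra! hneg
    have h₃ : (ballMax S n : ℝ) ≤ ballMax S 0 := by
      exact_mod_cast e ▸ le_ballMax hS.above hneg.le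
    have h₄ : (ballMin S 0 : ℝ) ≤ ballMin S n := by exact_mod_cast hS.ballMin_mono hn
    linarith
  have h₅ := hS.ballMax_TbbInv j
  have h₆ := hS'.ballMin_le (le_refl j)
  have h₇ : _root_.TbbInv S j = 2 * ballMin S j - ballMax S n - 2 * ballMin S 0 := by
    rw [← e]
    rfl
  have h₈ : (ballMin (_root_.TbbInv S) j : ℝ)
      ≤ 2 * ballMin S j - ballMax S n - 2 * ballMin S 0 := by
    rw [h₇] at h₆
    exact_mod_cast h₆
  refine ⟨L, (le_max_left _ _).trans hL, j, hj0, ?_, ?_⟩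
  · rw [h₅]
    push_cast
    linarith
  · rw [h₅]
    push_cast
    linarith

lemma not_hasRelDrops {S : ℤ → ℤ} (hS : ∀ k : ℕ, IsRev (TbbInv^[k] S)) {c δ : ℝ} (hδ : 0 < δ) :
    ¬ HasRelDrops c δ S := by
  intro h
  have hk : ∀ k : ℕ, HasRelDrops (c - k * δ) δ (TbbInv^[k] S) := by
    intro k
    induction k with
    | zero => simpa using h
    | succ k ih =>
      have hk' := hS (k + 1)
      rw [Function.iterate_succ_apply'] at hk' ⊢
      have := ih.TbbInv hδ (hS k) hk'
      convert this using 1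
      push_cast
      ring
  obtain ⟨k, hk'⟩ := exists_nat_gt ((c + 1) / δ)
  rw [div_lt_iff₀ hδ] at hk'
  obtain ⟨C, hC⟩ := hk k
  obtain ⟨L, hL, n, hn, h₁, -⟩ := hC (max 0 (C - ballMax (TbbInv^[k] S) 0 + 1))
  have h₂ := (le_max_left _ _).trans hL
  have h₃ := (le_max_right _ _).trans hL
  have h₄ : (ballMax (TbbInv^[k] S) 0 : ℝ) ≤ ballMax (TbbInv^[k] S) n := by
    exact_mod_cast ballMax_mono (hS k).above hn
  nlinarith

lemma inSplusSub_of_unbounded {S : ℤ → ℤ} (hS : ∀ k : ℕ, IsRev (TbbInv^[k] S))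
    (h : ∀ B, ∃ n, B < S n) : inSplusSub S := by
  have hS₀ : IsRev S := hS 0
  have hM : Tendsto (fun n => (ballMax S n : ℝ)) atTop atTop := by
    refine tendsto_intCast_atTop_atTop.comp
      (tendsto_atTop_atTop_of_monotone (ballMax_mono hS₀.above) fun b => ?_)
    obtain ⟨n, hn⟩ := h b
    exact ⟨n, hn.le.trans (le_ballMax hS₀.above le_rfl)⟩
  have h₁ : Tendsto (fun n => (S n : ℝ) / ballMax S n) atTop (𝓝 1) := by
    rw [tendsto_order]
    constructor
    · intro a ha
      by_contra hc
      refine not_hasRelDrops hS (c := 1) (sub_pos.2 ha) ⟨0, fun B => ?_⟩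
      obtain ⟨n, hn, hB, h0, hn0⟩ := ((not_eventually.1 hc).and_eventually
        ((hM.eventually_ge_atTop B).and ((hM.eventually_gt_atTop 0).and
          (eventually_ge_atTop 0)))).exists
      rw [not_lt, div_le_iff₀ h0] at hn
      have h₂ : (ballMin S n : ℝ) ≤ S n := by exact_mod_cast hS₀.ballMin_le le_rfl
      exact ⟨ballMax S n, hB, n, hn0, by linarith, by linarith⟩
    · intro b hb
      filter_upwards [hM.eventually_gt_atTop 0] with n hn
      refine lt_of_le_of_lt ?_ hb
      rw [div_le_one₀ hn]
      exact_mod_cast le_ballMax hS₀.above le_rfl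
  have h₂ : Tendsto (fun n : ℤ => 1 + Real.arctan n / ballMax S n) atTop (𝓝 1) := by
    have : Tendsto (fun n : ℤ => Real.arctan n) atTop (𝓝 (Real.pi / 2)) :=
      (Real.tendsto_arctan_atTop.mono_right nhdsWithin_le_nhds).comp tendsto_intCast_atTop_atTop
    simpa using (this.div_atTop hM).const_add 1
  refine ⟨fun n => ballMax S n + Real.arctan n, fun m n hmn => ?_, ?_⟩
  · have h₃ : (ballMax S m : ℝ) ≤ ballMax S n := by exact_mod_cast ballMax_mono hS₀.above hmn.le
    have h₄ : Real.arctan m < Real.arctan n := Real.arctan_strictMono (by exact_mod_cast hmn)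
    exact add_lt_add_of_le_of_lt h₃ h₄
  · have := h₁.div h₂ one_ne_zero
    rw [div_one] at this
    refine this.congr' ?_
    filter_upwards [hM.eventually_gt_atTop 0] with n hn
    rw [Pi.div_apply, div_div]
    congr 1
    field_simp

lemma dropLE_of_oscillatesIn {K : ℤ} (g : ℕ) : ∀ {S : ℤ → ℤ}, (∀ k : ℕ, IsRev (Tbb^[k] S)) →
    ∀ {a m l : ℤ}, OscillatesIn atTop a K S → m ≤ l → a + K - ballMax S l < g →
      S m ≤ S l + K := by
  induction g with
  | zero =>
    intro S hS a m l ha hml hg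
    have hS₀ : IsRev S := hS 0
    obtain ⟨j, -, e⟩ := exists_eq_ballMax hS₀.above l
    have := ha.le_of_isRev hS₀ j
    omega
  | succ g ih =>
    intro S hS a m l ha hml hg
    have hS₀ : IsRev S := hS 0
    have hS₁ : ∀ k : ℕ, IsRev (Tbb^[k] (Tbb S)) := fun k => hS (k + 1)
    by_contra! hc
    obtain ⟨l', hl', e₁, e₂⟩ := hS₀.exists_ge_eq_ballMax l
    have h₁ := ha.Tbb (ha.ballMax_atTop hS₀)
    have h₂ := le_ballMax (hS₁ 0).above hl'
    have h₃ := le_ballMax hS₀.above hml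
    simp only [Function.iterate_zero, id] at h₂
    have h₄ : Tbb S l = 2 * ballMax S l - S l - 2 * ballMax S 0 := rfl
    have h₅ : Tbb S l' = 2 * ballMax S l' - S l' - 2 * ballMax S 0 := rfl
    have := ih hS₁ h₁ hl' (by push_cast at hg; omega)
    omega

lemma inSplusCrit_of_bounded {S : ℤ → ℤ} (hS : ∀ k : ℕ, IsRev (Tbb^[k] S)) {B : ℤ}
    (hB : ∀ n, S n ≤ B) : inSplusCrit S := by
  have hS₀ : IsRev S := hS 0
  obtain ⟨A, ⟨n₁, hA⟩, hA'⟩ := Int.exists_greatest_of_bdd (P := fun z => ∃ n, S n = z)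
    ⟨B, by rintro z ⟨n, rfl⟩; exact hB n⟩ ⟨_, 0, rfl⟩
  replace hA' : ∀ n, S n ≤ A := fun n => hA' _ ⟨n, rfl⟩
  obtain ⟨a, ⟨n₀, ha⟩, ha'⟩ := Int.exists_greatest_of_bdd (P := fun z => ∃ n, ballMin S n = z)
    ⟨B, by rintro z ⟨n, rfl⟩; exact (hS₀.ballMin_le le_rfl).trans (hB n)⟩ ⟨_, 0, rfl⟩
  replace ha' : ∀ n, n₀ ≤ n → ballMin S n = a := fun n hn =>
    le_antisymm (ha' _ ⟨n, rfl⟩) (ha ▸ hS₀.ballMin_mono hn)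
  have hosc : OscillatesIn atTop a (A - a) S := by
    refine ⟨?_, ?_, ?_⟩
    · filter_upwards [eventually_ge_atTop n₀] with n hn
      have h₁ := hS₀.ballMin_le (le_refl n)
      have h₂ := ha' n hn
      have h₃ := hA' n
      omega
    · rw [frequently_atTop]
      intro N
      obtain ⟨m, hm, e⟩ := hS₀.exists_eq_ballMin (max N n₀)
      exact ⟨m, (le_max_left _ _).trans hm, by rw [e, ha' _ (le_max_right _ _)]⟩
    · refine (hS₀.top n₁).mono fun m hm => ?_
      have := hA' m
      omega
  refine ⟨A - a, ?_, inSplusK_iff.2 ⟨fun m l hml => ?_, a, hosc⟩⟩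
  · obtain ⟨N, hN⟩ := eventually_atTop.1 hosc.1
    have h₁ := hN N le_rfl
    have h₂ := hN (N + 1) (by omega)
    have h₃ := hS₀.inS0.2 (N + 1)
    rw [add_sub_cancel_right, abs_eq (by norm_num)] at h₃
    omega
  · refine dropLE_of_oscillatesIn (a + (A - a) - ballMax S l + 1).toNat hS hosc hml ?_
    omega

lemma inSplus_of_isRev {S : ℤ → ℤ} (hS : ∀ k : ℕ, IsRev (Tbb^[k] S))
    (hS' : ∀ k : ℕ, IsRev (TbbInv^[k] S)) : inSplusSub S ∨ inSplusCrit S := by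
  by_cases h : ∀ B, ∃ n, B < S n
  · exact Or.inl (inSplusSub_of_unbounded hS' h)
  · push Not at h
    obtain ⟨B, hB⟩ := h
    exact Or.inr (inSplusCrit_of_bounded hS hB)

lemma Tbb_iterate_pathRev (S : ℤ → ℤ) (k : ℕ) :
    Tbb^[k] (pathRev S) = pathRev (TbbInv^[k] S) :=
  ((Function.Semiconj.iterate_right (f := pathRev) (ga := TbbInv) (gb := Tbb)
    (fun S => (Tbb_pathRev S).symm) k).eq S).symm

lemma TbbInv_iterate_pathRev (S : ℤ → ℤ) (k : ℕ) :
    TbbInv^[k] (pathRev S) = pathRev (Tbb^[k] S) :=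
  ((Function.Semiconj.iterate_right (f := pathRev) (ga := Tbb) (gb := TbbInv)
    (fun S => (TbbInv_pathRev S).symm) k).eq S).symm

section Classes

variable {S : ℤ → ℤ}

lemma inSplus_pathRev (h : inSminusSub S ∨ inSminusCrit S) :
    inSplusSub (pathRev S) ∨ inSplusCrit (pathRev S) := by
  rcases h with ⟨F, hF, h⟩ | ⟨K, hK, h⟩
  · exact Or.inl ⟨_, hF.realRev, h.pathRev⟩
  · exact Or.inr ⟨K, hK, h.pathRev⟩

lemma inSminus_pathRev (h : inSplusSub S ∨ inSplusCrit S) :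
    inSminusSub (pathRev S) ∨ inSminusCrit (pathRev S) := by
  rcases h with ⟨F, hF, h⟩ | ⟨K, hK, h⟩
  · exact Or.inl ⟨_, hF.realRev, h.pathRev⟩
  · exact Or.inr ⟨K, hK, h.pathRev⟩

lemma above_and_bot_of_inSminus (hS : inS0 S) (h : inSminusSub S ∨ inSminusCrit S) :
    (∃ B, ∀ n ≤ 0, S n ≤ B) ∧ ∀ n, ∃ᶠ m in atBot, S m ≤ S n := by
  rcases h with ⟨F, hF, h⟩ | ⟨K, hK, h⟩
  · have ht := h.tendsto_path hF hS
    refine ⟨?_, fun n => (ht.eventually_le_atBot _).frequently⟩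
    obtain ⟨N, hN⟩ := eventually_atBot.1 (ht.eventually_le_atBot 0)
    obtain ⟨C, hC⟩ := ((Set.finite_Icc N 0).image S).bddAbove
    refine ⟨max 0 C, fun n hn => ?_⟩
    rcases le_total n N with h' | h'
    · exact le_max_of_le_left (hN n h')
    · exact le_max_of_le_right (hC ⟨n, ⟨h', hn⟩, rfl⟩)
  · obtain ⟨h₁, a, h₂⟩ := inSminusK_iff.1 h
    refine ⟨⟨S 0 + K, fun n hn => h₁ n 0 hn⟩, fun n => h₂.2.1.mono fun m hm => ?_⟩
    obtain ⟨l, hl, hln⟩ := (h₂.2.2.and_eventually (eventually_le_atBot n)).exists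
    have := h₁ l n hln
    omega

/-- Paths lying in one of the classes at each end. -/
structure InClasses (S : ℤ → ℤ) : Prop where
  inS0 : inS0 S
  minus : inSminusSub S ∨ inSminusCrit S
  plus : inSplusSub S ∨ inSplusCrit S

lemma InClasses.pathRev (h : InClasses S) : InClasses (pathRev S) :=
  ⟨h.inS0.pathRev, inSminus_pathRev h.plus, inSplus_pathRev h.minus⟩

lemma InClasses.isRev (h : InClasses S) : IsRev S := by
  obtain ⟨h₁, h₂⟩ := above_and_bot_of_inSminus h.inS0 h.minus
  obtain ⟨⟨B, hB⟩, h₄⟩ := above_and_bot_of_inSminus h.pathRev.inS0 h.pathRev.minus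
  refine ⟨h.inS0, h₁, ⟨-B, fun n hn => ?_⟩, fun n => ?_, h₂⟩
  · have := hB (-n) (by omega)
    simp only [_root_.pathRev, neg_neg] at this
    omega
  · refine (tendsto_neg_atBot_atTop (G := ℤ)).frequently ((h₄ (-n)).mono fun m hm => ?_)
    simp only [_root_.pathRev, neg_neg] at hm
    omega

lemma InClasses.Tbb (h : InClasses S) : InClasses (Tbb S) := by
  have hS := h.isRev
  refine ⟨h.inS0.Tbb hS.above, ?_, ?_⟩
  · rcases h.minus with ⟨F, hF, h'⟩ | ⟨K, hK, h'⟩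
    · exact Or.inl ⟨F, hF, h'.Tbb hF hS⟩
    · exact Or.inr ⟨K, hK, h'.Tbb hS⟩
  · rcases h.plus with ⟨F, hF, h'⟩ | ⟨K, hK, h'⟩
    · exact Or.inl ⟨F, hF, h'.Tbb hF hS⟩
    · exact Or.inr ⟨K, hK, h'.Tbb hS⟩

lemma InClasses.TbbInv (h : InClasses S) : InClasses (TbbInv S) :=
  TbbInv_eq S ▸ h.pathRev.Tbb.pathRev

lemma inSinv_iff_forall_isRev : inSinv S ↔
    (∀ k : ℕ, IsRev (Tbb^[k] S)) ∧ ∀ k : ℕ, IsRev (TbbInv^[k] S) := by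
  simp only [inSinv, inSrev_iff, Titer]
  constructor
  · refine fun h => ⟨fun k => by simpa using h k, fun k => ?_⟩
    rcases Nat.eq_zero_or_pos k with rfl | hk
    · simpa using h 0
    · have := h (-k)
      rwa [if_neg (by omega), neg_neg, Int.toNat_natCast] at this
  · rintro ⟨h₁, h₂⟩ k
    split_ifs
    · exact h₁ _
    · exact h₂ _

lemma Titer_induction {P : (ℤ → ℤ) → Prop} (hS : inSinv S)
    (h₁ : ∀ S, IsRev S → P S → P (Tbb S)) (h₂ : ∀ S, IsRev S → P S → P (TbbInv S)) (h : P S)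
    (k : ℤ) : P (Titer k S) := by
  obtain ⟨h₃, h₄⟩ := inSinv_iff_forall_isRev.1 hS
  have key₁ : ∀ k : ℕ, P (Tbb^[k] S) := by
    intro k
    induction k with
    | zero => exact h
    | succ k ih => exact Function.iterate_succ_apply' Tbb k S ▸ h₁ _ (h₃ k) ih
  have key₂ : ∀ k : ℕ, P (TbbInv^[k] S) := by
    intro k
    induction k with
    | zero => exact h
    | succ k ih => exact Function.iterate_succ_apply' TbbInv k S ▸ h₂ _ (h₄ k) ih
  rw [Titer]
  split_ifs
  · exact key₁ _
  · exact key₂ _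

lemma inSplusF.TbbInv {F : ℤ → ℝ} (h : inSplusF F S) (hF : StrictMono F) (hS : IsRev S) :
    inSplusF F (TbbInv S) := by
  have := (h.pathRev.Tbb hF.realRev hS.pathRev).pathRev
  rwa [← TbbInv_eq, realRev_realRev] at this

lemma inSminusF.TbbInv {F : ℤ → ℝ} (h : inSminusF F S) (hF : StrictMono F) (hS : IsRev S) :
    inSminusF F (TbbInv S) := by
  have := (h.pathRev.Tbb hF.realRev hS.pathRev).pathRev
  rwa [← TbbInv_eq, realRev_realRev] at this

lemma inSplusK.TbbInv {K : ℤ} (hS : IsRev S) (h : inSplusK K S) : inSplusK K (TbbInv S) :=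
  TbbInv_eq S ▸ (inSminusK.Tbb hS.pathRev h.pathRev).pathRev

lemma inSminusK.TbbInv {K : ℤ} (hS : IsRev S) (h : inSminusK K S) : inSminusK K (TbbInv S) :=
  TbbInv_eq S ▸ (inSplusK.Tbb hS.pathRev h.pathRev).pathRev

lemma inSinv_iff_inClasses : inSinv S ↔ InClasses S := by
  rw [inSinv_iff_forall_isRev]
  constructor
  · rintro ⟨h₁, h₂⟩
    refine ⟨(h₁ 0).inS0, ?_, inSplus_of_isRev h₁ h₂⟩
    rw [← pathRev_pathRev S]
    refine inSminus_pathRev (inSplus_of_isRev (fun k => ?_) fun k => ?_)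
    · exact Tbb_iterate_pathRev S k ▸ (h₂ k).pathRev
    · exact TbbInv_iterate_pathRev S k ▸ (h₁ k).pathRev
  · intro h
    have key₁ : ∀ k : ℕ, InClasses (_root_.Tbb^[k] S) := by
      intro k
      induction k with
      | zero => exact h
      | succ k ih => exact Function.iterate_succ_apply' _root_.Tbb k S ▸ ih.Tbb
    have key₂ : ∀ k : ℕ, InClasses (_root_.TbbInv^[k] S) := by
      intro k
      induction k with
      | zero => exact h
      | succ k ih => exact Function.iterate_succ_apply' _root_.TbbInv k S ▸ ih.TbbInv
    exact ⟨fun k => (key₁ k).isRev, fun k => (key₂ k).isRev⟩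

end Classes

/-- `S ∈ 𝒮^{inv}` iff `S ∈ 𝒮⁻_{*₁} ∩ 𝒮⁺_{*₂}` for some `*₁, *₂` each either a
strictly increasing `F : ℤ → ℝ` or an integer `K ≥ 1`; moreover the box-ball dynamics preserve
each of the classes `𝒮⁺_F`, `𝒮⁺_K`, `𝒮⁻_F`, `𝒮⁻_K`. -/
theorem stmt_8 :
    (∀ S : ℤ → ℤ, inS0 S →
      (inSinv S ↔ (inSminusSub S ∨ inSminusCrit S) ∧ (inSplusSub S ∨ inSplusCrit S))) ∧
    (∀ S : ℤ → ℤ, inSinv S → ∀ k : ℤ,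
      (∀ F : ℤ → ℝ, StrictMono F → inSplusF F S → inSplusF F (Titer k S)) ∧
      (∀ K : ℤ, 1 ≤ K → inSplusK K S → inSplusK K (Titer k S)) ∧
      (∀ F : ℤ → ℝ, StrictMono F → inSminusF F S → inSminusF F (Titer k S)) ∧
      (∀ K : ℤ, 1 ≤ K → inSminusK K S → inSminusK K (Titer k S))) := by
  refine ⟨fun S hS => ?_, fun S hS k => ⟨fun F hF h => ?_, fun K _ h => ?_, fun F hF h => ?_,
    fun K _ h => ?_⟩⟩
  · rw [inSinv_iff_inClasses]
    exact ⟨fun h => ⟨h.minus, h.plus⟩, fun h => ⟨hS, h.1, h.2⟩⟩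
  · exact Titer_induction hS (fun _ h₁ h₂ => h₂.Tbb hF h₁) (fun _ h₁ h₂ => h₂.TbbInv hF h₁) h k
  · exact Titer_induction hS (fun _ => inSplusK.Tbb) (fun _ => inSplusK.TbbInv) h k
  · exact Titer_induction hS (fun _ h₁ h₂ => h₂.Tbb hF h₁) (fun _ h₁ h₂ => h₂.TbbInv hF h₁) h k
  · exact Titer_induction hS (fun _ => inSminusK.Tbb) (fun _ => inSminusK.TbbInv) h k
end
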